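/- Let μ be the unique unitarily invariant Borel probability measure on the unit sphere S of ℂ^d, d = 2^n. Then for every P ∈ P_n with P ≠ I^{⊗n}: ∫_S ⟨v, P v⟩² dμ(v) = 1/(d+1), where ⟨v, Pv⟩ = v†Pv is a real number since P is Hermitian. -/

import Mathlib

open Matrix MeasureTheory

noncomputable section

/-- The four 2×2 Pauli matrices: `0 ↦ I`, `1 ↦ X`, `2 ↦ Y`, `3 ↦ Z`. -/
def pauli1 : Fin 4 → Matrix (Fin 2) (Fin 2) ℂ
  | 0 => !![1, 0; 0, 1]
  | 1 => !![0, 1; 1, 0]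
  | 2 => !![0, -Complex.I; Complex.I, 0]
  | 3 => !![1, 0; 0, -1]

/-- The `n`-qubit Pauli operator associated to the string `s : Fin n → Fin 4`. -/
def PauliOp (n : ℕ) (s : Fin n → Fin 4) :
    Matrix (Fin n → Fin 2) (Fin n → Fin 2) ℂ :=
  Matrix.of fun i j => ∏ a, pauli1 (s a) (i a) (j a)

/-- The Kronecker product of a family of 2×2 matrices. -/
def kronFamily {n : ℕ} (A : Fin n → Matrix (Fin 2) (Fin 2) ℂ) :
    Matrix (Fin n → Fin 2) (Fin n → Fin 2) ℂ :=
  Matrix.of fun i j => ∏ a, A a (i a) (j a)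

lemma pauliOp_eq_kronFamily (n : ℕ) (s : Fin n → Fin 4) :
    PauliOp n s = kronFamily fun a => pauli1 (s a) := rfl

lemma kronFamily_mul {n : ℕ} (A B : Fin n → Matrix (Fin 2) (Fin 2) ℂ) :
    kronFamily A * kronFamily B = kronFamily fun a => A a * B a := by
  ext i j
  simp only [kronFamily, Matrix.mul_apply, Matrix.of_apply, ← Finset.prod_mul_distrib]
  rw [Finset.prod_univ_sum, Fintype.piFinset_univ]

lemma kronFamily_one (n : ℕ) :
    kronFamily (fun _ : Fin n => (1 : Matrix (Fin 2) (Fin 2) ℂ)) = 1 := by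
  ext i j
  simp only [kronFamily, Matrix.of_apply, Matrix.one_apply, Finset.prod_ite_zero, funext_iff]
  simp

lemma kronFamily_smul {n : ℕ} (c : Fin n → ℂ) (A : Fin n → Matrix (Fin 2) (Fin 2) ℂ) :
    (kronFamily fun a => c a • A a) = (∏ a, c a) • kronFamily A := by
  ext i j
  simp [kronFamily, Finset.prod_mul_distrib]

/-- The commutation sign of two single-qubit Pauli matrices. -/
def pauliSign1 (s t : Fin 4) : ℝ := if s = 0 ∨ t = 0 ∨ s = t then 1 else -1

/-- The commutation sign of two Pauli operators. -/
def pauliSign {n : ℕ} (s t : Fin n → Fin 4) : ℝ := ∏ a, pauliSign1 (s a) (t a)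

lemma pauli1_conjTranspose (s : Fin 4) : (pauli1 s)ᴴ = pauli1 s := by
  fin_cases s <;> ext i j <;> fin_cases i <;> fin_cases j <;> simp [pauli1]

lemma pauli1_mul_self (s : Fin 4) : pauli1 s * pauli1 s = 1 := by
  fin_cases s <;> ext i j <;> fin_cases i <;> fin_cases j <;> simp [pauli1]

lemma pauli1_conj (s t : Fin 4) :
    pauli1 s * pauli1 t * pauli1 s = (pauliSign1 s t : ℂ) • pauli1 t := by
  fin_cases s <;> fin_cases t <;> ext i j <;> fin_cases i <;> fin_cases j <;>
    simp [pauli1, pauliSign1]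

lemma sum_pauli1_mul_pauli1 (i j k l : Fin 2) :
    ∑ t, pauli1 t i j * pauli1 t k l = if i = l ∧ j = k then 2 else 0 := by
  fin_cases i <;> fin_cases j <;> fin_cases k <;> fin_cases l <;>
    simp [pauli1, Fin.sum_univ_four] <;> norm_num

lemma sum_pauliSign1 {s : Fin 4} (hs : s ≠ 0) : ∑ t, pauliSign1 s t = 0 := by
  fin_cases s <;> simp [pauliSign1, Fin.sum_univ_four] at hs ⊢

lemma pauliSign_eq_or {n : ℕ} (s t : Fin n → Fin 4) :
    pauliSign s t = 1 ∨ pauliSign s t = -1 := by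
  refine Finset.prod_induction _ (fun x : ℝ => x = 1 ∨ x = -1) ?_ (Or.inl rfl) ?_
  · rintro a b (rfl | rfl) (rfl | rfl) <;> norm_num
  · intro a _
    unfold pauliSign1
    split_ifs <;> simp

lemma sum_pauliSign {n : ℕ} {s : Fin n → Fin 4} (hs : s ≠ fun _ => 0) :
    ∑ t, pauliSign s t = 0 := by
  obtain ⟨a, ha⟩ := Function.ne_iff.mp hs
  have h := Finset.prod_univ_sum (fun _ : Fin n => (Finset.univ : Finset (Fin 4)))
    (fun a t => pauliSign1 (s a) t)
  rw [Fintype.piFinset_univ] at h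
  simp only [pauliSign]
  rw [← h]
  exact Finset.prod_eq_zero (Finset.mem_univ a) (sum_pauliSign1 ha)

lemma pauliOp_conjTranspose (n : ℕ) (s : Fin n → Fin 4) : (PauliOp n s)ᴴ = PauliOp n s := by
  ext i j
  simp only [PauliOp, Matrix.conjTranspose_apply, Matrix.of_apply, star_prod]
  refine Finset.prod_congr rfl fun a _ => ?_
  rw [← Matrix.conjTranspose_apply, pauli1_conjTranspose]

lemma pauliOp_mul_self (n : ℕ) (s : Fin n → Fin 4) : PauliOp n s * PauliOp n s = 1 := by
  simp only [pauliOp_eq_kronFamily, kronFamily_mul, pauli1_mul_self, kronFamily_one]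

lemma pauliOp_conj (n : ℕ) (s t : Fin n → Fin 4) :
    PauliOp n s * PauliOp n t * PauliOp n s = (pauliSign s t : ℂ) • PauliOp n t := by
  simp only [pauliOp_eq_kronFamily, kronFamily_mul, pauli1_conj, kronFamily_smul, pauliSign,
    Complex.ofReal_prod]

lemma sum_pauliOp_mul_pauliOp (n : ℕ) (i j k l : Fin n → Fin 2) :
    ∑ t, PauliOp n t i j * PauliOp n t k l = if i = l ∧ j = k then 2 ^ n else 0 := by
  simp only [PauliOp, Matrix.of_apply, ← Finset.prod_mul_distrib]
  have h := Finset.prod_univ_sum (fun _ : Fin n => (Finset.univ : Finset (Fin 4)))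
    (fun a t => pauli1 t (i a) (j a) * pauli1 t (k a) (l a))
  rw [Fintype.piFinset_univ] at h
  rw [← h]
  simp only [sum_pauli1_mul_pauli1, Finset.prod_ite_zero, funext_iff]
  simp [forall_and]

/-- The complex quadratic form `v ↦ ⟨v, A v⟩` of a matrix `A`. -/
def quadForm {ι : Type*} [Fintype ι] (A : Matrix ι ι ℂ) (v : ι → ℂ) : ℂ := star v ⬝ᵥ A *ᵥ v

lemma quadForm_mulVec {ι : Type*} [Fintype ι] (A B : Matrix ι ι ℂ) (v : ι → ℂ) :
    quadForm A (B *ᵥ v) = quadForm (Bᴴ * A * B) v := by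
  simp only [quadForm, Matrix.star_mulVec, ← Matrix.mulVec_mulVec, Matrix.mul_assoc]
  rw [← Matrix.dotProduct_mulVec]

lemma ofReal_re_quadForm {ι : Type*} [Fintype ι] {A : Matrix ι ι ℂ} (hA : Aᴴ = A)
    (v : ι → ℂ) : ((quadForm A v).re : ℂ) = quadForm A v := by
  rw [← Complex.conj_eq_iff_re]
  change star (star v ⬝ᵥ A *ᵥ v) = star v ⬝ᵥ A *ᵥ v
  conv_rhs => rw [Matrix.star_dotProduct, Matrix.star_mulVec, hA, ← Matrix.dotProduct_mulVec]

lemma continuous_quadForm {ι : Type*} [Fintype ι] (A : Matrix ι ι ℂ) :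
    Continuous (quadForm A) := by
  unfold quadForm
  fun_prop

lemma sum_quadForm_mul_quadForm (n : ℕ) (v w : (Fin n → Fin 2) → ℂ) :
    ∑ t, quadForm (PauliOp n t) v * quadForm (PauliOp n t) w =
      2 ^ n * ((star v ⬝ᵥ w) * (star w ⬝ᵥ v)) := by
  have hq (t) : quadForm (PauliOp n t) v * quadForm (PauliOp n t) w =
      ∑ i, ∑ k, ∑ j, ∑ l, (star (v i) * v j * star (w k) * w l) *
        (PauliOp n t i j * PauliOp n t k l) := by
    have hexp (u : (Fin n → Fin 2) → ℂ) : quadForm (PauliOp n t) u =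
        ∑ i, ∑ j, star (u i) * (PauliOp n t i j * u j) := by
      simp only [quadForm, dotProduct, Matrix.mulVec, Pi.star_apply, Finset.mul_sum]
    rw [hexp, hexp, Finset.sum_mul_sum]
    refine Finset.sum_congr rfl fun i _ => Finset.sum_congr rfl fun k _ => ?_
    rw [Finset.sum_mul_sum]
    refine Finset.sum_congr rfl fun j _ => Finset.sum_congr rfl fun l _ => ?_
    ring
  simp only [hq, dotProduct, Pi.star_apply]
  rw [Finset.sum_mul_sum, Finset.mul_sum, Finset.sum_comm]
  refine Finset.sum_congr rfl fun i _ => ?_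
  rw [Finset.mul_sum, Finset.sum_comm]
  refine Finset.sum_congr rfl fun k _ => ?_
  rw [Finset.sum_comm]
  have hj (j) : ∑ t, ∑ l, (star (v i) * v j * star (w k) * w l) *
        (PauliOp n t i j * PauliOp n t k l) =
      if j = k then star (v i) * v j * star (w k) * w i * 2 ^ n else 0 := by
    rw [Finset.sum_comm]
    simp only [← Finset.mul_sum, sum_pauliOp_mul_pauliOp, ite_and, mul_ite, mul_zero,
      Finset.sum_ite_eq, Finset.mem_univ, if_true]
  simp only [hj, Finset.sum_ite_eq', Finset.mem_univ, if_true]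
  ring

lemma sum_sq_re_quadForm (n : ℕ) {v : (Fin n → Fin 2) → ℂ} (hv : star v ⬝ᵥ v = 1) :
    ∑ t, (quadForm (PauliOp n t) v).re ^ 2 = 2 ^ n := by
  have h := sum_quadForm_mul_quadForm n v v
  apply Complex.ofReal_injective
  push_cast
  simp only [ofReal_re_quadForm (pauliOp_conjTranspose n _), sq]
  rw [h, hv]
  simp

lemma sum_pauliSign_mul_sq_re_quadForm (n : ℕ) (s : Fin n → Fin 4) (v : (Fin n → Fin 2) → ℂ) :
    ∑ t, pauliSign s t * (quadForm (PauliOp n t) v).re ^ 2 =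
      2 ^ n * (quadForm (PauliOp n s) v).re ^ 2 := by
  have h := sum_quadForm_mul_quadForm n v (PauliOp n s *ᵥ v)
  have hw : star (PauliOp n s *ᵥ v) ⬝ᵥ v = quadForm (PauliOp n s) v := by
    rw [Matrix.star_mulVec, pauliOp_conjTranspose, ← Matrix.dotProduct_mulVec, quadForm]
  rw [hw] at h
  apply Complex.ofReal_injective
  push_cast
  simp only [ofReal_re_quadForm (pauliOp_conjTranspose n _), sq]
  refine Eq.trans (Finset.sum_congr rfl fun t _ => ?_) h
  rw [quadForm_mulVec, pauliOp_conjTranspose, pauliOp_conj]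
  simp only [quadForm, Matrix.smul_mulVec, dotProduct_smul, smul_eq_mul]
  ring

/-- Two anticommuting Hermitian involutions are conjugate by a unitary. -/
lemma exists_unitary_conj_of_anticommute {ι : Type*} [Fintype ι] [DecidableEq ι]
    {A B : Matrix ι ι ℂ} (hA : Aᴴ = A) (hB : Bᴴ = B) (hAA : A * A = 1) (hBB : B * B = 1)
    (hAB : A * B * A = -B) :
    ∃ U ∈ Matrix.unitaryGroup ι ℂ, Uᴴ * A * U = B := by
  have hanti : A * B = -(B * A) := by
    have := congrArg (· * A) hAB
    simpa [Matrix.mul_assoc, hAA] using this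
  have hc : ((Real.sqrt 2 : ℂ))⁻¹ * ((Real.sqrt 2 : ℂ))⁻¹ = 1 / 2 := by
    rw [← mul_inv, ← Complex.ofReal_mul, Real.mul_self_sqrt (by norm_num)]
    norm_num
  have hU : (((Real.sqrt 2 : ℂ))⁻¹ • (A + B))ᴴ = ((Real.sqrt 2 : ℂ))⁻¹ • (A + B) := by
    simp [Matrix.conjTranspose_smul, hA, hB]
  refine ⟨((Real.sqrt 2 : ℂ))⁻¹ • (A + B), ?_, ?_⟩
  · rw [Matrix.mem_unitaryGroup_iff, Matrix.star_eq_conjTranspose, hU, smul_mul_smul_comm, hc,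
      add_mul, mul_add, mul_add, hAA, hBB, hanti]
    module
  · have h1 : B * A * B = -A := by
      rw [Matrix.mul_assoc, hanti, mul_neg, ← Matrix.mul_assoc, hBB, one_mul]
    rw [hU, smul_mul_assoc, smul_mul_smul_comm, hc, add_mul, mul_add, add_mul, add_mul, hAA, h1,
      Matrix.mul_assoc B, hAA]
    simp only [one_mul, mul_one]
    module

/-- For the unitarily invariant probability measure on the unit sphere of `ℂ^{2^n}`
(characterized here as any probability measure concentrated on the unit sphere and
invariant under every unitary), the second moment of `⟨v, P v⟩` for a non-identity
Pauli `P` equals `1/(2^n + 1)`. -/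
theorem haar_sphere_pauli_second_moment (n : ℕ) (hn : 1 ≤ n)
    (μ : Measure ((Fin n → Fin 2) → ℂ)) [IsProbabilityMeasure μ]
    (hsupp : μ {v | star v ⬝ᵥ v = 1} = 1)
    (hinv : ∀ U ∈ Matrix.unitaryGroup (Fin n → Fin 2) ℂ,
      Measure.map (fun v => U.mulVec v) μ = μ)
    (s : Fin n → Fin 4) (hs : s ≠ fun _ => 0) :
    ∫ v, ((star v ⬝ᵥ (PauliOp n s).mulVec v).re) ^ 2 ∂μ =
      1 / (2 ^ n + 1) := by
  have hsphere : ∀ᵐ v ∂μ, star v ⬝ᵥ v = 1 := by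
    have hmeas : MeasurableSet {v : (Fin n → Fin 2) → ℂ | star v ⬝ᵥ v = 1} :=
      (isClosed_eq (by fun_prop) continuous_const).measurableSet
    exact (prob_compl_eq_zero_iff hmeas).mpr hsupp
  have hcont (t : Fin n → Fin 4) :
      Continuous fun v => (quadForm (PauliOp n t) v).re ^ 2 :=
    (Complex.continuous_re.comp (continuous_quadForm _)).pow 2
  have hintegrable (t : Fin n → Fin 4) :
      Integrable (fun v => (quadForm (PauliOp n t) v).re ^ 2) μ := by
    refine Integrable.of_bound (hcont t).aestronglyMeasurable (2 ^ n) ?_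
    filter_upwards [hsphere] with v hv
    rw [Real.norm_of_nonneg (sq_nonneg _), ← sum_sq_re_quadForm n hv]
    exact Finset.single_le_sum (f := fun t => (quadForm (PauliOp n t) v).re ^ 2)
      (fun _ _ => sq_nonneg _) (Finset.mem_univ t)
  set F : (Fin n → Fin 4) → ℝ := fun t => ∫ v, (quadForm (PauliOp n t) v).re ^ 2 ∂μ with hF
  have hFeq (t : Fin n → Fin 4) (ht : pauliSign s t = -1) : F t = F s := by
    obtain ⟨U, hU, hUs⟩ := exists_unitary_conj_of_anticommute (pauliOp_conjTranspose n s)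
      (pauliOp_conjTranspose n t) (pauliOp_mul_self n s) (pauliOp_mul_self n t)
      (by rw [pauliOp_conj, ht]; simp)
    have hUm : Continuous fun v : (Fin n → Fin 2) → ℂ => U *ᵥ v := by fun_prop
    simp only [hF]
    conv_rhs => rw [← hinv U hU]
    rw [integral_map hUm.aemeasurable (hcont s).aestronglyMeasurable]
    simp only [quadForm_mulVec, hUs]
  have hsum : ∑ t, (1 - pauliSign s t) * F t = 2 ^ n - 2 ^ n * F s := by
    simp only [hF, ← integral_const_mul]
    rw [← integral_finsetSum _ fun t _ => (hintegrable t).const_mul _]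
    have hrhs : 2 ^ n - ∫ v, 2 ^ n * (quadForm (PauliOp n s) v).re ^ 2 ∂μ =
        ∫ v, (2 ^ n - 2 ^ n * (quadForm (PauliOp n s) v).re ^ 2) ∂μ := by
      rw [integral_sub (integrable_const _) ((hintegrable s).const_mul _)]
      simp
    rw [hrhs]
    refine integral_congr_ae ?_
    filter_upwards [hsphere] with v hv
    simp only [sub_mul, one_mul, Finset.sum_sub_distrib]
    rw [sum_sq_re_quadForm n hv, sum_pauliSign_mul_sq_re_quadForm]
  have hleft : ∑ t, (1 - pauliSign s t) * F t = (2 ^ n * 2 ^ n) * F s := by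
    have h (t) : (1 - pauliSign s t) * F t = (1 - pauliSign s t) * F s := by
      rcases pauliSign_eq_or s t with h | h
      · simp [h]
      · rw [hFeq t h]
    simp only [h]
    rw [← Finset.sum_mul, Finset.sum_sub_distrib, sum_pauliSign hs]
    simp [← mul_pow]
    norm_num
  change F s = _
  have hpos : (0 : ℝ) < 2 ^ n := by positivity
  rw [hleft] at hsum
  rw [eq_div_iff (by positivity)]
  apply mul_left_cancel₀ hpos.ne'
  linarith
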